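/- Let φ : P₁ → ℝ ∪ {+∞} be proper, convex and lower semicontinuous with respect to the Wasserstein metric. Then the set M = {(f, η) ∈ Lip(X) × ℝ : ∫ f dμ + η ≤ φ(μ) for all μ ∈ P₁} is nonempty; i.e., φ admits a Lipschitz affine minorant. -/

import Mathlib

open MeasureTheory

/-- The Wasserstein distance of order 1, defined as the infimum of expected distances
over all couplings. -/
noncomputable def W1 {X : Type*} [MetricSpace X] [MeasurableSpace X] (μ ν : Measure X) : ℝ :=
  sInf {c : ℝ | ∃ π : Measure (X × X), IsProbabilityMeasure π ∧
    π.map Prod.fst = μ ∧ π.map Prod.snd = ν ∧ c = ∫ p, dist p.1 p.2 ∂π}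

/-- Membership in the Wasserstein space of order 1: a Borel probability measure with
finite first moment. -/
def MemP1 {X : Type*} [MetricSpace X] [MeasurableSpace X] (x₀ : X) (μ : Measure X) : Prop :=
  IsProbabilityMeasure μ ∧ Integrable (fun x => dist x₀ x) μ

open scoped NNReal

lemma W1_nonneg' {X : Type*} [MetricSpace X] [MeasurableSpace X] (μ ν : Measure X) :
    0 ≤ W1 μ ν := by
  apply Real.sInf_nonneg
  rintro c ⟨π, _, _, _, rfl⟩
  exact integral_nonneg fun p => dist_nonneg

lemma memP1_mix {X : Type*} [MetricSpace X] [MeasurableSpace X] (x₀ : X) {μ ν : Measure X}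
    (hμ : MemP1 x₀ μ) (hν : MemP1 x₀ ν) {t : ℝ} (h0 : 0 ≤ t) (h1 : t ≤ 1) :
    MemP1 x₀ ((ENNReal.ofReal t) • μ + (ENNReal.ofReal (1 - t)) • ν) := by
  obtain ⟨_, hi⟩ := hμ
  obtain ⟨_, hj⟩ := hν
  refine ⟨⟨?_⟩, ?_⟩
  · simp [← ENNReal.ofReal_add h0 (sub_nonneg.2 h1)]
  · exact (hi.smul_measure ENNReal.ofReal_ne_top).add_measure
      (hj.smul_measure ENNReal.ofReal_ne_top)

lemma W1_mix_le {X : Type*} [MetricSpace X] [TopologicalSpace.SeparableSpace X]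
    [MeasurableSpace X] [BorelSpace X] (x₀ : X) {μ ν : Measure X}
    (hμ : MemP1 x₀ μ) (hν : MemP1 x₀ ν) {t : ℝ} (h0 : 0 ≤ t) (h1 : t ≤ 1) :
    W1 ((ENNReal.ofReal t) • μ + (ENNReal.ofReal (1 - t)) • ν) ν ≤
      t * ((∫ x, dist x₀ x ∂μ) + ∫ x, dist x₀ x ∂ν) := by
  haveI : SecondCountableTopology X := UniformSpace.secondCountable_of_separable X
  obtain ⟨_, hi⟩ := hμ
  obtain ⟨_, hj⟩ := hν
  have hsum : ENNReal.ofReal t + ENNReal.ofReal (1 - t) = 1 := by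
    simp [← ENNReal.ofReal_add h0 (sub_nonneg.2 h1)]
  have hdiag : Measurable (fun x : X => (x, x)) := by fun_prop
  have hdm : Measurable (fun p : X × X => dist p.1 p.2) := by fun_prop
  have hI1 : Integrable (fun p : X × X => dist x₀ p.1) (μ.prod ν) := hi.comp_fst ν
  have hI2 : Integrable (fun p : X × X => dist x₀ p.2) (μ.prod ν) := hj.comp_snd μ
  have hle : ∀ p : X × X, dist p.1 p.2 ≤ dist x₀ p.1 + dist x₀ p.2 := fun p => by
    rw [dist_comm x₀ p.1]; exact dist_triangle _ _ _
  have hI : Integrable (fun p : X × X => dist p.1 p.2) (μ.prod ν) :=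
    (hI1.add hI2).mono' hdm.aestronglyMeasurable (Filter.Eventually.of_forall fun p => by
      rw [Real.norm_of_nonneg dist_nonneg]; exact hle p)
  have hJ : Integrable (fun p : X × X => dist p.1 p.2) (ν.map (fun x => (x, x))) := by
    rw [integrable_map_measure hdm.aestronglyMeasurable hdiag.aemeasurable]
    have : (fun p : X × X => dist p.1 p.2) ∘ (fun x : X => (x, x)) = fun _ => (0 : ℝ) := by
      ext x; simp
    rw [this]; exact integrable_zero _ _ _
  have hJ0 : ∫ p, dist p.1 p.2 ∂(ν.map (fun x => (x, x))) = 0 := by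
    rw [integral_map hdiag.aemeasurable hdm.aestronglyMeasurable]; simp
  have hprod : ∫ p, dist p.1 p.2 ∂(μ.prod ν) ≤
      (∫ x, dist x₀ x ∂μ) + ∫ x, dist x₀ x ∂ν := by
    calc _ ≤ ∫ p, (dist x₀ p.1 + dist x₀ p.2) ∂(μ.prod ν) :=
          integral_mono hI (hI1.add hI2) hle
      _ = _ := by
          rw [integral_add hI1 hI2, integral_fun_fst (fun x => dist x₀ x),
            integral_fun_snd (fun x => dist x₀ x)]
          simp
  let π : Measure (X × X) := (ENNReal.ofReal t) • (μ.prod ν) +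
    (ENNReal.ofReal (1 - t)) • (ν.map (fun x => (x, x)))
  have hpi : ∫ p, dist p.1 p.2 ∂π = t * ∫ p, dist p.1 p.2 ∂(μ.prod ν) := by
    simp only [π]
    rw [integral_add_measure (hI.smul_measure ENNReal.ofReal_ne_top)
      (hJ.smul_measure ENNReal.ofReal_ne_top), integral_smul_measure, integral_smul_measure, hJ0]
    simp [ENNReal.toReal_ofReal h0]
  have hmem : W1 ((ENNReal.ofReal t) • μ + (ENNReal.ofReal (1 - t)) • ν) ν ≤
      ∫ p, dist p.1 p.2 ∂π := by
    apply csInf_le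
    · refine ⟨0, ?_⟩
      rintro c ⟨π, _, _, _, rfl⟩
      exact integral_nonneg fun p => dist_nonneg
    · haveI : IsProbabilityMeasure (ν.map (fun x => (x, x))) :=
        Measure.isProbabilityMeasure_map hdiag.aemeasurable
      refine ⟨π, ⟨?_⟩, ?_, ?_, rfl⟩
      · simp [π, hsum]
      · simp only [π]
        rw [Measure.map_add _ _ measurable_fst, Measure.map_smul, Measure.map_smul,
          Measure.map_map measurable_fst hdiag, Measure.map_fst_prod]
        have : (Prod.fst ∘ fun x : X => (x, x)) = id := rfl
        rw [this, Measure.map_id]; simp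
      · simp only [π]
        rw [Measure.map_add _ _ measurable_snd, Measure.map_smul, Measure.map_smul,
          Measure.map_map measurable_snd hdiag, Measure.map_snd_prod]
        have : (Prod.snd ∘ fun x : X => (x, x)) = id := rfl
        rw [this, Measure.map_id]; simp [← add_smul, hsum]
  rw [hpi] at hmem
  exact hmem.trans (mul_le_mul_of_nonneg_left hprod h0)

/-- A proper, convex and `W₁`-lower semicontinuous function `φ : P₁ → ℝ ∪ {+∞}` admits a
Lipschitz affine minorant: there are a Lipschitz `f` and `η ∈ ℝ` with
`∫ f dμ + η ≤ φ(μ)` for all `μ ∈ P₁`. -/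
theorem stmt_14 {X : Type*} [MetricSpace X] [TopologicalSpace.SeparableSpace X]
    [CompleteSpace X] [MeasurableSpace X] [BorelSpace X] (x₀ : X)
    (φ : Measure X → EReal) (hbot : ∀ μ, MemP1 x₀ μ → φ μ ≠ ⊥)
    (hproper : ∃ μ, MemP1 x₀ μ ∧ φ μ ≠ ⊤)
    (hconv : ∀ μ, MemP1 x₀ μ → ∀ ν, MemP1 x₀ ν → ∀ t : ℝ, 0 ≤ t → t ≤ 1 →
      φ ((ENNReal.ofReal t) • μ + (ENNReal.ofReal (1 - t)) • ν) ≤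
        (t : EReal) * φ μ + ((1 - t : ℝ) : EReal) * φ ν)
    (hlsc : ∀ μ : ℕ → Measure X, (∀ n, MemP1 x₀ (μ n)) → ∀ ν, MemP1 x₀ ν →
      Filter.Tendsto (fun n => W1 (μ n) ν) Filter.atTop (nhds 0) →
      φ ν ≤ Filter.liminf (fun n => φ (μ n)) Filter.atTop) :
    ∃ (f : X → ℝ) (K : ℝ≥0) (η : ℝ), LipschitzWith K f ∧
      ∀ μ, MemP1 x₀ μ → (((∫ x, f x ∂μ) + η : ℝ) : EReal) ≤ φ μ := by
  obtain ⟨μ0, hμ0, htop⟩ := hproper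
  obtain ⟨c, hc⟩ : ∃ c : ℝ, φ μ0 = c :=
    ⟨(φ μ0).toReal, (EReal.coe_toReal htop (hbot _ hμ0)).symm⟩
  by_contra hcon
  set m : Measure X → ℝ := fun μ => ∫ x, dist x₀ x ∂μ with hm
  have hm0 : ∀ μ, 0 ≤ m μ := fun μ => integral_nonneg fun x => dist_nonneg
  have key : ∀ n : ℕ, ∃ μ, MemP1 x₀ μ ∧ ∃ a : ℝ, φ μ = a ∧
      a < c - (n + 1) * (m μ + m μ0 + 1) := by
    intro n
    by_contra hn
    push Not at hn
    apply hcon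
    refine ⟨fun x => -((n : ℝ) + 1) * dist x₀ x, (n : ℝ≥0) + 1, c - (n + 1) * (m μ0 + 1), ?_, ?_⟩
    · apply LipschitzWith.of_dist_le_mul
      intro x y
      have h := abs_dist_sub_le x y x₀
      rw [Real.dist_eq, ← mul_sub, abs_mul, abs_neg, abs_of_nonneg (by positivity)]
      rw [dist_comm x₀ x, dist_comm x₀ y]
      push_cast
      gcongr
    · intro μ hμ
      by_cases ht : φ μ = ⊤
      · rw [ht]; exact le_top
      have ha := (EReal.coe_toReal ht (hbot _ hμ)).symm
      have h := hn μ hμ _ ha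
      rw [ha, EReal.coe_le_coe_iff, integral_const_mul]
      change -((n : ℝ) + 1) * m μ + _ ≤ _
      linarith
  choose μ hμ a ha hlt using key
  let D : ℕ → ℝ := fun n => (n + 1) * (m (μ n) + m μ0 + 1)
  have hD1 : ∀ n, 1 ≤ D n := by
    intro n
    have h1 := hm0 (μ n)
    have h2 := hm0 μ0
    have h3 : (0 : ℝ) ≤ n := n.cast_nonneg
    simp only [D]
    nlinarith [mul_nonneg h3 h1, mul_nonneg h3 h2]
  let t : ℕ → ℝ := fun n => (D n)⁻¹
  have ht0 : ∀ n, 0 ≤ t n := fun n => inv_nonneg.2 (by linarith [hD1 n])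
  have ht1 : ∀ n, t n ≤ 1 := fun n => inv_le_one_of_one_le₀ (hD1 n)
  have htD : ∀ n, t n * D n = 1 := fun n => inv_mul_cancel₀ (by linarith [hD1 n])
  have hl := hlsc (fun n => (ENNReal.ofReal (t n)) • μ n + (ENNReal.ofReal (1 - t n)) • μ0)
    (fun n => memP1_mix x₀ (hμ n) hμ0 (ht0 n) (ht1 n)) μ0 hμ0 (by
      refine squeeze_zero (fun n => W1_nonneg' _ _) (fun n => ?_)
        (tendsto_one_div_add_atTop_nhds_zero_nat (𝕜 := ℝ))
      refine (W1_mix_le x₀ (hμ n) hμ0 (ht0 n) (ht1 n)).trans ?_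
      change t n * (m (μ n) + m μ0) ≤ _
      have hn : (0 : ℝ) < n + 1 := by positivity
      rw [le_div_iff₀ hn]
      have := htD n
      simp only [D] at this
      nlinarith [mul_nonneg (ht0 n) hn.le])
  have hub : ∀ n, φ ((ENNReal.ofReal (t n)) • μ n + (ENNReal.ofReal (1 - t n)) • μ0) ≤
      ((c - 1 : ℝ) : EReal) := by
    intro n
    refine (hconv _ (hμ n) _ hμ0 (t n) (ht0 n) (ht1 n)).trans ?_
    rw [ha, hc, ← EReal.coe_mul, ← EReal.coe_mul, ← EReal.coe_add, EReal.coe_le_coe_iff]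
    have h1 := mul_le_mul_of_nonneg_left (hlt n).le (ht0 n)
    have h2 := htD n
    simp only [D] at h2
    nlinarith
  have h2 : Filter.liminf (fun n => φ ((ENNReal.ofReal (t n)) • μ n +
      (ENNReal.ofReal (1 - t n)) • μ0)) Filter.atTop ≤ ((c - 1 : ℝ) : EReal) :=
    (Filter.liminf_le_liminf (Filter.Eventually.of_forall hub)).trans
      (Filter.liminf_const _).le
  have h3 := hl.trans h2
  rw [hc, EReal.coe_le_coe_iff] at h3
  linarith
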